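/- Call a typical 7-configuration P of type F if P = {p₀, p₁, …, p₆}, where P₀ = {p₁,…,p₆} is a hexagonal typical 6-configuration labeled consecutively in the cyclic order of its convex position in an affine chart ℝ² = ℙ²(ℝ)∖L, with p₁ dominant in P₀, the three affine lines p₁p₄, p₂p₃, p₅p₆ pairwise non-parallel and not concurrent (so that they bound a unique bounded open triangle in ℝ²), p₀ lying in this bounded open triangle, and this open triangle disjoint from all 15 lines through pairs of points of P₀. Then any two typical 7-configurations of type F can be joined by a Q-deformation; i.e., they form a single Q-deformation class. -/

import Mathlib

open scoped LinearAlgebra.Projectivization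
open Projectivization

noncomputable section

/-- The real projective plane: the projectivization of `ℝ³`. -/
abbrev RP2 := ℙ ℝ (Fin 3 → ℝ)

/-- The quotient topology on the real projective plane. -/
instance : TopologicalSpace RP2 :=
  inferInstanceAs (TopologicalSpace (Quotient (projectivizationSetoid ℝ (Fin 3 → ℝ))))

/-- Three points of `ℙ²(ℝ)` are collinear if they admit linearly dependent representatives. -/
def Collin (a b c : RP2) : Prop :=
  ¬ LinearIndependent ℝ ![a.rep, b.rep, c.rep]

/-- The conic (zero set in `ℙ²(ℝ)`) associated to a quadratic form on `ℝ³`. -/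
def ConicSet (q : QuadraticForm ℝ (Fin 3 → ℝ)) : Set RP2 := {p : RP2 | q p.rep = 0}

/-- A set of points is coconic if some conic contains all of them. -/
def Coconic (s : Set RP2) : Prop :=
  ∃ q : QuadraticForm ℝ (Fin 3 → ℝ), q ≠ 0 ∧ ∀ p ∈ s, q p.rep = 0

/-- A labeled `n`-configuration is simple if it is injective and has no collinear triple. -/
def SimpleCfg {n : ℕ} (f : Fin n → RP2) : Prop :=
  Function.Injective f ∧
    ∀ i j k : Fin n, i ≠ j → i ≠ k → j ≠ k → ¬ Collin (f i) (f j) (f k)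

/-- A labeled `n`-configuration is typical if it is simple and no six of its points are coconic. -/
def TypicalCfg {n : ℕ} (f : Fin n → RP2) : Prop :=
  SimpleCfg f ∧ ∀ g : Fin 6 → Fin n, Function.Injective g → ¬ Coconic (Set.range (f ∘ g))

/-- A projective line: the set of points whose representatives lie in a 2-dimensional
subspace of `ℝ³`. -/
def IsProjLine (L : Set RP2) : Prop :=
  ∃ W : Submodule ℝ (Fin 3 → ℝ), Module.finrank ℝ W = 2 ∧ L = {p : RP2 | p.rep ∈ W}

/-- `p` lies inside the conic of `q` if every projective line through `p` meets the conic. -/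
def InsideConic (q : QuadraticForm ℝ (Fin 3 → ℝ)) (p : RP2) : Prop :=
  ∀ L : Set RP2, IsProjLine L → p ∈ L → (L ∩ ConicSet q).Nonempty

/-- `p` lies outside the conic of `q` if some projective line through `p` misses the conic. -/
def OutsideConic (q : QuadraticForm ℝ (Fin 3 → ℝ)) (p : RP2) : Prop :=
  ∃ L : Set RP2, IsProjLine L ∧ p ∈ L ∧ L ∩ ConicSet q = ∅

/-- A point `f i` of a configuration is dominant if it lies outside every conic passing
through all the other points of the configuration. -/
def Dominant {n : ℕ} (f : Fin n → RP2) (i : Fin n) : Prop :=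
  ∀ q : QuadraticForm ℝ (Fin 3 → ℝ), q ≠ 0 → (∀ j, j ≠ i → q ((f j).rep) = 0) →
    OutsideConic q (f i)

/-- A point `f i` of a configuration is subdominant if it lies inside every conic passing
through all the other points of the configuration. -/
def Subdominant {n : ℕ} (f : Fin n → RP2) (i : Fin n) : Prop :=
  ∀ q : QuadraticForm ℝ (Fin 3 → ℝ), q ≠ 0 → (∀ j, j ≠ i → q ((f j).rep) = 0) →
    InsideConic q (f i)

/-- The affine chart determined by a nonzero linear functional `φ` (with `L∞ = {φ = 0}`):
a point off `L∞` is sent to its representative rescaled to lie on the affine plane `φ = 1`. -/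
def chart (φ : (Fin 3 → ℝ) →ₗ[ℝ] ℝ) (p : RP2) : Fin 3 → ℝ := (φ p.rep)⁻¹ • p.rep

/-- Convex position with respect to the affine chart of `φ`: the line `{φ = 0}` misses the
configuration, and in the chart every point lies outside the convex hull of the others. -/
def ConvexPosWith {n : ℕ} (φ : (Fin 3 → ℝ) →ₗ[ℝ] ℝ) (f : Fin n → RP2) : Prop :=
  φ ≠ 0 ∧ (∀ i, φ (f i).rep ≠ 0) ∧
    ∀ i, chart φ (f i) ∉ convexHull ℝ (chart φ '' (f '' {j | j ≠ i}))

/-- A configuration is in convex position if it is so in some affine chart. -/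
def ConvexPos {n : ℕ} (f : Fin n → RP2) : Prop := ∃ φ, ConvexPosWith φ f

/-- The labeling of a configuration is consecutive for the convex position in the chart of `φ`:
each pair `f i`, `f (i+1)` (cyclically) spans an edge of the convex polygon, i.e. is cut out by
an affine functional which is strictly larger on both of them than on all the other points. -/
def ConsecWith {n : ℕ} [NeZero n] (φ : (Fin 3 → ℝ) →ₗ[ℝ] ℝ) (f : Fin n → RP2) : Prop :=
  ConvexPosWith φ f ∧
    ∀ i : Fin n, ∃ ψ : (Fin 3 → ℝ) →ₗ[ℝ] ℝ,
      ψ (chart φ (f i)) = ψ (chart φ (f (i + 1))) ∧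
      ∀ j : Fin n, j ≠ i → j ≠ i + 1 → ψ (chart φ (f j)) < ψ (chart φ (f i))

/-- A configuration is in convex position with consecutive cyclic labeling. -/
def ConsecConvexPos {n : ℕ} [NeZero n] (f : Fin n → RP2) : Prop := ∃ φ, ConsecWith φ f

/-- A Q-deformation (an `n`-tuple of continuous paths through typical configurations). -/
def QDeformFam (n : ℕ) (γ : Fin n → unitInterval → RP2) : Prop :=
  (∀ i, Continuous (γ i)) ∧ ∀ t : unitInterval, TypicalCfg (fun i => γ i t)

end
noncomputable section

/-- The affine line through two points of `ℝ³` (used inside the affine chart `{φ = 1}`). -/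
def AffLine (u v : Fin 3 → ℝ) : Set (Fin 3 → ℝ) := {x | ∃ t : ℝ, x = u + t • (v - u)}

/-- The bounded open triangle with vertices `A`, `B`, `C` (strictly positive convex
combinations). -/
def OpenTri (A B C : Fin 3 → ℝ) : Set (Fin 3 → ℝ) :=
  {x | ∃ a b c : ℝ, 0 < a ∧ 0 < b ∧ 0 < c ∧ a + b + c = 1 ∧ x = a • A + b • B + c • C}

/-- A typical 7-configuration `p₀, p₁, …, p₆` of type F: `p₁,…,p₆` is a hexagonal typical
6-configuration consecutively labeled in some affine chart with `p₁` dominant, the three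
affine lines `p₁p₄`, `p₂p₃`, `p₅p₆` are pairwise non-parallel and non-concurrent (their three
pairwise intersection points `A`, `B`, `C` exist and form a nondegenerate triangle, which
bounds the bounded open triangle), the point `p₀` lies in this bounded open triangle, and
this open triangle is disjoint from all 15 lines through pairs of points of `p₁,…,p₆`. -/
def TypeF (f : Fin 7 → RP2) : Prop :=
  TypicalCfg f ∧
  ∃ φ : (Fin 3 → ℝ) →ₗ[ℝ] ℝ,
    ConsecWith φ (fun i : Fin 6 => f i.succ) ∧
    Dominant (fun i : Fin 6 => f i.succ) 0 ∧
    ∃ A B C : Fin 3 → ℝ,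
      A ∈ AffLine (chart φ (f 1)) (chart φ (f 4)) ∧
      A ∈ AffLine (chart φ (f 2)) (chart φ (f 3)) ∧
      B ∈ AffLine (chart φ (f 2)) (chart φ (f 3)) ∧
      B ∈ AffLine (chart φ (f 5)) (chart φ (f 6)) ∧
      C ∈ AffLine (chart φ (f 5)) (chart φ (f 6)) ∧
      C ∈ AffLine (chart φ (f 1)) (chart φ (f 4)) ∧
      AffineIndependent ℝ ![A, B, C] ∧
      chart φ (f 0) ∈ OpenTri A B C ∧
      ∀ i j : Fin 7, i ≠ 0 → j ≠ 0 → i ≠ j →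
        ∀ x ∈ OpenTri A B C,
          x ∉ Submodule.span ℝ ({(f i).rep, (f j).rep} : Set (Fin 3 → ℝ))

section PosDet

open Matrix

theorem joinedIn_det_pos_transvection (t : TransvectionStruct (Fin 3) ℝ) :
    JoinedIn {M : Matrix (Fin 3) (Fin 3) ℝ | 0 < M.det} 1 t.toMatrix := by
  obtain ⟨i, j, hij, c⟩ := t
  refine JoinedIn.ofLine (f := fun s : ℝ => transvection i j (s * c)) ?_ ?_ ?_ ?_
  · refine Continuous.continuousOn ?_
    refine continuous_const.add (continuous_matrix fun k l => ?_)
    simp only [Matrix.single, of_apply]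
    split_ifs <;> fun_prop
  · simp
  · simp [TransvectionStruct.toMatrix]
  · rintro _ ⟨s, -, rfl⟩
    simp [det_transvection_of_ne _ _ hij]

theorem joinedIn_det_pos_line {M N : Matrix (Fin 3) (Fin 3) ℝ}
    (h : ∀ s ∈ Set.Icc (0 : ℝ) 1, 0 < ((1 - s) • M + s • N).det) :
    JoinedIn {M : Matrix (Fin 3) (Fin 3) ℝ | 0 < M.det} M N := by
  refine JoinedIn.ofLine (f := fun s : ℝ => (1 - s) • M + s • N) ?_ ?_ ?_ ?_
  · refine Continuous.continuousOn ?_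
    fun_prop
  · simp
  · simp
  · rintro _ ⟨s, hs, rfl⟩
    exact h s hs

theorem joinedIn_det_pos_mul {M N : Matrix (Fin 3) (Fin 3) ℝ}
    (hM : JoinedIn {M : Matrix (Fin 3) (Fin 3) ℝ | 0 < M.det} 1 M)
    (hN : JoinedIn {M : Matrix (Fin 3) (Fin 3) ℝ | 0 < M.det} 1 N) :
    JoinedIn {M : Matrix (Fin 3) (Fin 3) ℝ | 0 < M.det} 1 (M * N) := by
  have h := hM.mul hN
  rw [mul_one] at h
  refine h.mono ?_
  rintro _ ⟨A, hA, B, hB, rfl⟩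
  simp only [Set.mem_ofPred_eq, det_mul] at *
  positivity

theorem combo_pos {s a b : ℝ} (hs : s ∈ Set.Icc (0 : ℝ) 1) (ha : 0 < a) (hb : 0 < b) :
    0 < (1 - s) * a + s * b := by
  obtain ⟨h0, h1⟩ := hs
  rcases h0.eq_or_lt with rfl | h0
  · simpa using ha
  · have := mul_nonneg (sub_nonneg.2 h1) ha.le
    have := mul_pos h0 hb
    linarith

theorem sq_add_sq_pos (s : ℝ) : 0 < (1 - s) * (1 - s) + s * s := by
  nlinarith [sq_nonneg (2 * s - 1)]

theorem joinedIn_det_pos_pos_diagonal {D : Fin 3 → ℝ} (hD : ∀ i, 0 < D i) :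
    JoinedIn {M : Matrix (Fin 3) (Fin 3) ℝ | 0 < M.det} 1 (diagonal D) := by
  refine joinedIn_det_pos_line fun s hs => ?_
  have h i := combo_pos hs one_pos (hD i)
  have := mul_pos (mul_pos (h 0) (h 1)) (h 2)
  simpa [det_fin_three, diagonal, one_apply] using this

/-- The half turns about the coordinate axes are connected to the identity. -/
theorem joinedIn_det_pos_half_turn {D : Fin 3 → ℝ}
    (hD : D = ![1, -1, -1] ∨ D = ![-1, 1, -1] ∨ D = ![-1, -1, 1]) :
    JoinedIn {M : Matrix (Fin 3) (Fin 3) ℝ | 0 < M.det} 1 (diagonal D) := by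
  have key (J : Matrix (Fin 3) (Fin 3) ℝ)
      (h1 : ∀ s : ℝ, ((1 - s) • (1 : Matrix (Fin 3) (Fin 3) ℝ) + s • J).det =
        (1 - s) * (1 - s) + s * s)
      (h2 : ∀ s : ℝ, ((1 - s) • J + s • diagonal D).det = (1 - s) * (1 - s) + s * s) :
      JoinedIn {M : Matrix (Fin 3) (Fin 3) ℝ | 0 < M.det} 1 (diagonal D) :=
    (joinedIn_det_pos_line fun s _ => h1 s ▸ sq_add_sq_pos s).trans
      (joinedIn_det_pos_line fun s _ => h2 s ▸ sq_add_sq_pos s)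
  rcases hD with rfl | rfl | rfl
  · refine key !![1, 0, 0; 0, 0, -1; 0, 1, 0] (fun s => ?_) (fun s => ?_) <;>
    · rw [det_fin_three]
      simp [one_apply]
      try ring
  · refine key !![0, 0, -1; 0, 1, 0; 1, 0, 0] (fun s => ?_) (fun s => ?_) <;>
    · rw [det_fin_three]
      simp [one_apply]
      try ring
  · refine key !![0, -1, 0; 1, 0, 0; 0, 0, 1] (fun s => ?_) (fun s => ?_) <;>
    · rw [det_fin_three]
      simp [one_apply]
      try ring

theorem joinedIn_det_pos_diagonal {D : Fin 3 → ℝ} (hD : 0 < (diagonal D).det) :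
    JoinedIn {M : Matrix (Fin 3) (Fin 3) ℝ | 0 < M.det} 1 (diagonal D) := by
  rw [det_diagonal, Fin.prod_univ_three] at hD
  have turn (S : Fin 3 → ℝ) (hS : S = ![1, -1, -1] ∨ S = ![-1, 1, -1] ∨ S = ![-1, -1, 1])
      (h : ∀ i, 0 < S i * D i) :
      JoinedIn {M : Matrix (Fin 3) (Fin 3) ℝ | 0 < M.det} 1 (diagonal D) := by
    have e : diagonal D = diagonal S * diagonal (fun i => S i * D i) := by
      rw [diagonal_mul_diagonal]
      congr 1
      funext i
      rcases hS with rfl | rfl | rfl <;> fin_cases i <;> simp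
    rw [e]
    exact joinedIn_det_pos_mul (joinedIn_det_pos_half_turn hS) (joinedIn_det_pos_pos_diagonal h)
  have h0 : D 0 ≠ 0 := by rintro h; simp [h] at hD
  have h1 : D 1 ≠ 0 := by rintro h; simp [h] at hD
  have h2 : D 2 ≠ 0 := by rintro h; simp [h] at hD
  rcases h0.lt_or_gt with h0 | h0 <;> rcases h1.lt_or_gt with h1 | h1 <;>
    rcases h2.lt_or_gt with h2 | h2
  · nlinarith [mul_pos_of_neg_of_neg h0 h1]
  · exact turn _ (.inr (.inr rfl)) (by simp [Fin.forall_fin_succ, *])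
  · exact turn _ (.inr (.inl rfl)) (by simp [Fin.forall_fin_succ, *])
  · nlinarith [mul_pos h1 h2]
  · exact turn _ (.inl rfl) (by simp [Fin.forall_fin_succ, *])
  · nlinarith [mul_pos h0 h2]
  · nlinarith [mul_pos h0 h1]
  · exact joinedIn_det_pos_pos_diagonal (by simp [Fin.forall_fin_succ, *])

/-- The group of real `3 × 3` matrices of positive determinant is path connected. -/
theorem joinedIn_det_pos {M N : Matrix (Fin 3) (Fin 3) ℝ} (hM : 0 < M.det) (hN : 0 < N.det) :
    JoinedIn {M : Matrix (Fin 3) (Fin 3) ℝ | 0 < M.det} M N := by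
  have key (A : Matrix (Fin 3) (Fin 3) ℝ) (hA : 0 < A.det) :
      JoinedIn {M : Matrix (Fin 3) (Fin 3) ℝ | 0 < M.det} 1 A :=
    diagonal_transvection_induction _ A
      (fun D hD => joinedIn_det_pos_diagonal (hD ▸ hA)) joinedIn_det_pos_transvection
      (fun _ _ => joinedIn_det_pos_mul)
  exact (key M hM).symm.trans (key N hN)

end PosDet

section Model

open Matrix

/-- Normal form for type F configurations: the triangle is the positive octant, with `p₀` at its
centre, and `p₁, p₄`, `p₂, p₃`, `p₅, p₆` lie on the three sides, outside the triangle. -/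
def modelVec (a : Fin 6 → ℝ) : Fin 7 → Fin 3 → ℝ :=
  ![![1, 1, 1], ![1, -a 0, 0], ![0, 1, -a 1], ![0, 1, -a 2], ![1, -a 3, 0], ![-a 4, 0, 1],
    ![-a 5, 0, 1]]

/-- The parameters of the normal forms, up to reflection, of hexagonal configurations with
dominant `p₁`. -/
def Chamber (a : Fin 6 → ℝ) : Prop :=
  (∀ i, 0 < a i) ∧ a 0 < a 3 ∧ a 2 < a 1 ∧ a 4 < a 5 ∧ a 0 * a 1 * a 5 < 1 ∧
    1 < a 3 * a 2 * a 4 ∧ a 0 * a 1 * a 2 * a 3 * a 4 * a 5 < 1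

/-- The configuration `f` is the image of a normal form under the projective transformation with
matrix `M`. -/
def IsModel (f : Fin 7 → RP2) (M : Matrix (Fin 3) (Fin 3) ℝ) (a : Fin 6 → ℝ) : Prop :=
  ∀ i, ∃ c : ℝ, c ≠ 0 ∧ (f i).rep = c • (modelVec a i ᵥ* M)

theorem modelVec_ne_zero (a : Fin 6 → ℝ) (i : Fin 7) : modelVec a i ≠ 0 := by
  intro h
  have h0 := congrFun h 0
  have h1 := congrFun h 1
  have h2 := congrFun h 2
  fin_cases i <;> simp [modelVec] at h0 h1 h2

theorem vecMul_ne_zero_of_det_ne_zero {M : Matrix (Fin 3) (Fin 3) ℝ} (hM : M.det ≠ 0)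
    {v : Fin 3 → ℝ} (hv : v ≠ 0) : v ᵥ* M ≠ 0 := fun h =>
  hv (eq_zero_of_vecMul_eq_zero hM h)

theorem linearIndependent_iff_det_ne_zero (u v w : Fin 3 → ℝ) :
    LinearIndependent ℝ ![u, v, w] ↔ (Matrix.of ![u, v, w]).det ≠ 0 := by
  rw [← isUnit_iff_ne_zero, ← isUnit_iff_isUnit_det, ← linearIndependent_rows_iff_isUnit]
  rfl

theorem det_of_smul_vecMul (M : Matrix (Fin 3) (Fin 3) ℝ) (r s t : ℝ) (u v w : Fin 3 → ℝ) :
    (Matrix.of ![r • (u ᵥ* M), s • (v ᵥ* M), t • (w ᵥ* M)]).det =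
      r * s * t * (Matrix.of ![u, v, w]).det * M.det := by
  rw [det_fin_three, det_fin_three, det_fin_three]
  simp [vecMul, dotProduct, Fin.sum_univ_three]
  ring

theorem collin_iff_of_isModel {f : Fin 7 → RP2} {M : Matrix (Fin 3) (Fin 3) ℝ} {a : Fin 6 → ℝ}
    (hM : M.det ≠ 0) (hf : IsModel f M a) (i j k : Fin 7) :
    Collin (f i) (f j) (f k) ↔
      (Matrix.of ![modelVec a i, modelVec a j, modelVec a k]).det = 0 := by
  obtain ⟨r, hr, hi⟩ := hf i
  obtain ⟨s, hs, hj⟩ := hf j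
  obtain ⟨t, ht, hk⟩ := hf k
  rw [Collin, linearIndependent_iff_det_ne_zero, hi, hj, hk, det_of_smul_vecMul]
  simp [hr, hs, ht, hM]

theorem det_modelVec_ne_zero_of_lt {a : Fin 6 → ℝ} (ha : Chamber a) {i j k : Fin 7}
    (hij : i < j) (hjk : j < k) :
    (Matrix.of ![modelVec a i, modelVec a j, modelVec a k]).det ≠ 0 := by
  obtain ⟨hpos, h03, h21, h45, hlt, hgt, -⟩ := ha
  have p0 := hpos 0
  have p1 := hpos 1
  have p2 := hpos 2
  have p3 := hpos 3
  have p4 := hpos 4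
  have p5 := hpos 5
  have d03 := sub_pos.2 h03
  have d21 := sub_pos.2 h21
  have d45 := sub_pos.2 h45
  have m {x y z x' y' z' : ℝ} (hx : x ≤ x') (hy : y ≤ y') (hz : z ≤ z') (x0 : 0 < x)
      (y0 : 0 < y) (z0 : 0 < z) : x * y * z ≤ x' * y' * z' := by
    have := x0.trans_le hx
    have := y0.trans_le hy
    gcongr
  have q1 := (m le_rfl le_rfl h45.le p0 p1 p4).trans_lt hlt
  have q2 := (m le_rfl h21.le le_rfl p0 p2 p5).trans_lt hlt
  have q3 := (m le_rfl h21.le h45.le p0 p2 p4).trans_lt hlt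
  have q4 := hgt.trans_le (m le_rfl le_rfl h45.le p3 p2 p4)
  have q5 := hgt.trans_le (m le_rfl h21.le le_rfl p3 p2 p4)
  have q6 := hgt.trans_le (m le_rfl h21.le h45.le p3 p2 p4)
  rw [det_fin_three]
  have r01 := mul_pos p0 p1
  have r02 := mul_pos p0 p2
  have r04 := mul_pos p0 p4
  have r05 := mul_pos p0 p5
  have r31 := mul_pos p3 p1
  have r32 := mul_pos p3 p2
  have r34 := mul_pos p3 p4
  have r35 := mul_pos p3 p5
  have r14 := mul_pos p1 p4
  have r15 := mul_pos p1 p5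
  have r24 := mul_pos p2 p4
  have r25 := mul_pos p2 p5
  have e1 := mul_pos p1 d03
  have e2 := mul_pos p2 d03
  have e4 := mul_pos p4 d21
  have e5 := mul_pos p5 d21
  have e0 := mul_pos p0 d45
  have e3 := mul_pos p3 d45
  intro h
  fin_cases i <;> fin_cases j <;> try exact absurd hij (by decide)
  all_goals fin_cases k <;> try exact absurd hjk (by decide)
  all_goals
    simp [modelVec] at h
    linarith

theorem det_modelVec_ne_zero {a : Fin 6 → ℝ} (ha : Chamber a) {i j k : Fin 7}
    (hij : i ≠ j) (hik : i ≠ k) (hjk : j ≠ k) :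
    (Matrix.of ![modelVec a i, modelVec a j, modelVec a k]).det ≠ 0 := by
  have swap₁ (u v w : Fin 3 → ℝ) :
      (Matrix.of ![v, u, w]).det = -(Matrix.of ![u, v, w]).det := by
    simp [det_fin_three]; ring
  have swap₂ (u v w : Fin 3 → ℝ) :
      (Matrix.of ![u, w, v]).det = -(Matrix.of ![u, v, w]).det := by
    simp [det_fin_three]; ring
  have D {i j k : Fin 7} := @det_modelVec_ne_zero_of_lt a ha i j k
  rcases hij.lt_or_gt with h1 | h1 <;> rcases hik.lt_or_gt with h2 | h2 <;>
    rcases hjk.lt_or_gt with h3 | h3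
  · exact D h1 h3
  · rw [swap₂]; exact neg_ne_zero.2 (D h2 h3)
  · exact absurd (h1.trans h3) h2.asymm
  · rw [swap₂, swap₁, neg_neg]; exact D h2 h1
  · rw [swap₁]; exact neg_ne_zero.2 (D h1 h2)
  · exact absurd (h2.trans h3) h1.asymm
  · rw [swap₁, swap₂, neg_neg]; exact D h3 h2
  · rw [swap₁, swap₂, swap₁, neg_neg]; exact neg_ne_zero.2 (D h3 h1)

/-- A quadratic form on `ℝ³` in the coordinates given by the rows of a matrix. -/
theorem quadraticForm_vecMul (q : QuadraticForm ℝ (Fin 3 → ℝ)) (M : Matrix (Fin 3) (Fin 3) ℝ) :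
    ∃ A B C D E F : ℝ, ∀ v : Fin 3 → ℝ, q (v ᵥ* M) =
      A * v 0 ^ 2 + B * v 1 ^ 2 + C * v 2 ^ 2 + D * (v 0 * v 1) + E * (v 1 * v 2) +
        F * (v 2 * v 0) := by
  refine ⟨q (M.row 0), q (M.row 1), q (M.row 2), QuadraticMap.polar q (M.row 0) (M.row 1),
    QuadraticMap.polar q (M.row 1) (M.row 2), QuadraticMap.polar q (M.row 2) (M.row 0), fun v => ?_⟩
  have e : v ᵥ* M = v 0 • M.row 0 + v 1 • M.row 1 + v 2 • M.row 2 := by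
    rw [vecMul_eq_sum, Fin.sum_univ_three]
    rfl
  rw [e, QuadraticMap.map_add q, QuadraticMap.map_add q]
  simp only [QuadraticMap.map_smul, QuadraticMap.polar_add_left, QuadraticMap.polar_smul_left,
    QuadraticMap.polar_smul_right, smul_eq_mul, QuadraticMap.polar_comm q (M.row 2) (M.row 0)]
  ring

theorem roots_quadratic {A B C a b : ℝ} (hab : a ≠ b) (ha : A - B * a + C * a ^ 2 = 0)
    (hb : A - B * b + C * b ^ 2 = 0) : A = C * (a * b) ∧ B = C * (a + b) := by
  have h : B = C * (a + b) := by
    have : (a - b) * (B - C * (a + b)) = 0 := by linear_combination hb - ha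
    have := (mul_eq_zero.1 this).resolve_left (sub_ne_zero.2 hab)
    linarith
  exact ⟨by rw [h] at ha; linear_combination ha, h⟩

/-- No conic passes through the centre of the octant, two points on each of two sides, and one
point on the third side, all of them off the octant. -/
theorem conic_centre {A B C D E F a b b' c c' : ℝ} (ha : 0 < a) (hb : 0 < b) (hb' : 0 < b')
    (hc : 0 < c) (hc' : 0 < c') (hbb : b ≠ b') (hcc : c ≠ c')
    (h0 : A + B + C + D + E + F = 0) (h1 : A - D * a + B * a ^ 2 = 0)
    (h2 : B - E * b + C * b ^ 2 = 0) (h3 : B - E * b' + C * b' ^ 2 = 0)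
    (h4 : C - F * c + A * c ^ 2 = 0) (h5 : C - F * c' + A * c' ^ 2 = 0) :
    A = 0 ∧ B = 0 ∧ C = 0 ∧ D = 0 ∧ E = 0 ∧ F = 0 := by
  obtain ⟨rfl, rfl⟩ := roots_quadratic hcc h4 h5
  obtain ⟨rfl, rfl⟩ := roots_quadratic hbb h2 h3
  have hA : A * (a + a * (c * c' * (b * b')) + a * (c * c') +
      (1 + c * c' * (b * b') * a ^ 2) + a * (c * c' * (b + b')) + a * (c + c')) = 0 := by
    linear_combination a * h0 + h1
  have hA : A = 0 := (mul_eq_zero.1 hA).resolve_right (by positivity)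
  subst hA
  have : D = 0 := by simpa [ha.ne'] using h1
  simp [this]

theorem modelVec_not_coconic {a : Fin 6 → ℝ} (ha : Chamber a) (m : Fin 7) {A B C D E F : ℝ}
    (h : ∀ j, j ≠ m → A * modelVec a j 0 ^ 2 + B * modelVec a j 1 ^ 2 + C * modelVec a j 2 ^ 2 +
      D * (modelVec a j 0 * modelVec a j 1) + E * (modelVec a j 1 * modelVec a j 2) +
        F * (modelVec a j 2 * modelVec a j 0) = 0) :
    A = 0 ∧ B = 0 ∧ C = 0 ∧ D = 0 ∧ E = 0 ∧ F = 0 := by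
  obtain ⟨hpos, h03, h21, h45, -, -, hS⟩ := ha
  have p0 := hpos 0
  have p1 := hpos 1
  have p2 := hpos 2
  have p3 := hpos 3
  have p4 := hpos 4
  have p5 := hpos 5
  have e0 (hm : 0 ≠ m) : A + B + C + D + E + F = 0 := by simpa [modelVec] using h 0 hm
  have e1 (hm : 1 ≠ m) : A - D * a 0 + B * a 0 ^ 2 = 0 := by
    have := h 1 hm; simp [modelVec] at this; linarith
  have e2 (hm : 2 ≠ m) : B - E * a 1 + C * a 1 ^ 2 = 0 := by
    have := h 2 hm; simp [modelVec] at this; linarith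
  have e3 (hm : 3 ≠ m) : B - E * a 2 + C * a 2 ^ 2 = 0 := by
    have := h 3 hm; simp [modelVec] at this; linarith
  have e4 (hm : 4 ≠ m) : A - D * a 3 + B * a 3 ^ 2 = 0 := by
    have := h 4 hm; simp [modelVec] at this; linarith
  have e5 (hm : 5 ≠ m) : C - F * a 4 + A * a 4 ^ 2 = 0 := by
    have := h 5 hm; simp [modelVec] at this; linarith
  have e6 (hm : 6 ≠ m) : C - F * a 5 + A * a 5 ^ 2 = 0 := by
    have := h 6 hm; simp [modelVec] at this; linarith
  have e0' (hm : 0 ≠ m) : B + C + A + E + F + D = 0 := by linarith [e0 hm]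
  have e0'' (hm : 0 ≠ m) : C + A + B + F + D + E = 0 := by linarith [e0 hm]
  clear h
  fin_cases m
  · obtain ⟨hA, hD⟩ := roots_quadratic h03.ne (e1 (by decide)) (e4 (by decide))
    obtain ⟨hB, hE⟩ := roots_quadratic h21.ne (e3 (by decide)) (e2 (by decide))
    obtain ⟨hC, hF⟩ := roots_quadratic h45.ne (e5 (by decide)) (e6 (by decide))
    have : A * (1 - a 0 * a 1 * a 2 * a 3 * a 4 * a 5) = 0 := by
      linear_combination hA + a 0 * a 3 * hB + a 0 * a 3 * a 1 * a 2 * hC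
    have : A = 0 := (mul_eq_zero.1 this).resolve_right (by linarith)
    rw [this, zero_mul] at hC hF
    rw [hC, zero_mul] at hB hE
    rw [hB, zero_mul] at hD
    exact ⟨this, hB, hC, hD, hE, hF⟩
  · exact conic_centre p3 p1 p2 p4 p5 h21.ne' h45.ne (e0 (by decide)) (e4 (by decide))
      (e2 (by decide)) (e3 (by decide)) (e5 (by decide)) (e6 (by decide))
  · obtain ⟨hB, hC, hA, hE, hF, hD⟩ := conic_centre p2 p4 p5 p0 p3 h45.ne h03.ne
      (e0' (by decide)) (e3 (by decide))
      (e5 (by decide)) (e6 (by decide)) (e1 (by decide)) (e4 (by decide))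
    exact ⟨hA, hB, hC, hD, hE, hF⟩
  · obtain ⟨hB, hC, hA, hE, hF, hD⟩ := conic_centre p1 p4 p5 p0 p3 h45.ne h03.ne
      (e0' (by decide)) (e2 (by decide))
      (e5 (by decide)) (e6 (by decide)) (e1 (by decide)) (e4 (by decide))
    exact ⟨hA, hB, hC, hD, hE, hF⟩
  · exact conic_centre p0 p1 p2 p4 p5 h21.ne' h45.ne (e0 (by decide)) (e1 (by decide))
      (e2 (by decide)) (e3 (by decide)) (e5 (by decide)) (e6 (by decide))
  · obtain ⟨hC, hA, hB, hF, hD, hE⟩ := conic_centre p5 p0 p3 p1 p2 h03.ne h21.ne'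
      (e0'' (by decide)) (e6 (by decide))
      (e1 (by decide)) (e4 (by decide)) (e2 (by decide)) (e3 (by decide))
    exact ⟨hA, hB, hC, hD, hE, hF⟩
  · obtain ⟨hC, hA, hB, hF, hD, hE⟩ := conic_centre p4 p0 p3 p1 p2 h03.ne h21.ne'
      (e0'' (by decide)) (e5 (by decide))
      (e1 (by decide)) (e4 (by decide)) (e2 (by decide)) (e3 (by decide))
    exact ⟨hA, hB, hC, hD, hE, hF⟩

theorem exists_forall_ne_mem_range {g : Fin 6 → Fin 7} (hg : Function.Injective g) :
    ∃ m, ∀ j, j ≠ m → j ∈ Set.range g := by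
  have h : ((Finset.univ.image g)ᶜ).card = 1 := by
    rw [Finset.card_compl, Finset.card_image_of_injective _ hg]
    simp
  obtain ⟨m, hm⟩ := Finset.card_eq_one.1 h
  refine ⟨m, fun j hj => ?_⟩
  by_contra hjg
  have : j ∈ (Finset.univ.image g)ᶜ := by simpa using hjg
  rw [hm, Finset.mem_singleton] at this
  exact hj this

theorem typicalCfg_of_isModel {f : Fin 7 → RP2} {M : Matrix (Fin 3) (Fin 3) ℝ} {a : Fin 6 → ℝ}
    (hM : M.det ≠ 0) (ha : Chamber a) (hf : IsModel f M a) : TypicalCfg f := by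
  have third : ∀ i j : Fin 7, ∃ k, i ≠ k ∧ j ≠ k := by decide
  refine ⟨⟨fun i j hij => ?_, fun i j k hij hik hjk => ?_⟩, fun g hg => ?_⟩
  · by_contra hne
    obtain ⟨k, hik, hjk⟩ : ∃ k : Fin 7, i ≠ k ∧ j ≠ k := third i j
    refine det_modelVec_ne_zero ha hne hik hjk ((collin_iff_of_isModel hM hf i j k).1 ?_)
    intro h
    have := h.injective (a₁ := 0) (a₂ := 1) (by simp [hij])
    simp at this
  · rw [collin_iff_of_isModel hM hf]
    exact det_modelVec_ne_zero ha hij hik hjk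
  · rintro ⟨q, hq, hz⟩
    obtain ⟨m, hm⟩ := exists_forall_ne_mem_range hg
    obtain ⟨A, B, C, D, E, F, hform⟩ := quadraticForm_vecMul q M
    obtain ⟨rfl, rfl, rfl, rfl, rfl, rfl⟩ :=
        modelVec_not_coconic (A := A) (B := B) (C := C) (D := D) (E := E) (F := F) ha m fun j hj => by
      obtain ⟨l, rfl⟩ := hm j hj
      have h0 := hz _ ⟨l, rfl⟩
      obtain ⟨c, hc, hrep⟩ := hf (g l)
      rw [Function.comp_apply, hrep, QuadraticMap.map_smul, hform] at h0
      simpa [hc] using h0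
    refine hq (QuadraticMap.ext fun v => ?_)
    have := hform (v ᵥ* M⁻¹)
    rw [vecMul_vecMul, nonsing_inv_mul _ (isUnit_iff_ne_zero.2 hM), vecMul_one] at this
    simpa using this

end Model

section Dominance

open Matrix

theorem quadraticForm_neg_of_anisotropic {W : Submodule ℝ (Fin 3 → ℝ)}
    {q : QuadraticForm ℝ (Fin 3 → ℝ)} (hW : ∀ w ∈ W, w ≠ 0 → q w ≠ 0) {p : Fin 3 → ℝ}
    (hp : p ∈ W) (hqp : q p < 0) {w : Fin 3 → ℝ} (hw : w ∈ W) (hw0 : w ≠ 0) : q w < 0 := by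
  refine (hW w hw hw0).lt_of_le (not_lt.1 fun hpos => ?_)
  have hd : 0 ≤ discrim (q p) (QuadraticMap.polar q p w) (q w) := by
    rw [discrim]
    nlinarith [sq_nonneg (QuadraticMap.polar q p w)]
  obtain ⟨t, ht⟩ := exists_quadratic_eq_zero hqp.ne ⟨_, (Real.mul_self_sqrt hd).symm⟩
  have hz : q (t • p + w) = 0 := by
    rw [QuadraticMap.map_add q, QuadraticMap.map_smul, QuadraticMap.polar_smul_left, smul_eq_mul,
      smul_eq_mul]
    linarith
  by_cases h0 : t • p + w = 0
  · rw [add_comm] at h0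
    rw [eq_neg_of_add_eq_zero_left h0, QuadraticMap.map_neg, QuadraticMap.map_smul,
      smul_eq_mul] at hpos
    nlinarith [mul_self_nonneg t]
  · exact hW _ (W.add_mem (W.smul_mem t hp) hw) h0 hz

theorem exists_quadraticForm_vecMul {M : Matrix (Fin 3) (Fin 3) ℝ} (hM : M.det ≠ 0)
    (A B C D E F : ℝ) : ∃ q : QuadraticForm ℝ (Fin 3 → ℝ), ∀ v : Fin 3 → ℝ, q (v ᵥ* M) =
      A * v 0 ^ 2 + B * v 1 ^ 2 + C * v 2 ^ 2 + D * (v 0 * v 1) + E * (v 1 * v 2) +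
        F * (v 2 * v 0) := by
  let x (i : Fin 3) : (Fin 3 → ℝ) →ₗ[ℝ] ℝ := LinearMap.proj i ∘ₗ (M⁻¹).vecMulLinear
  refine ⟨A • QuadraticMap.linMulLin (x 0) (x 0) + B • QuadraticMap.linMulLin (x 1) (x 1) +
    C • QuadraticMap.linMulLin (x 2) (x 2) + D • QuadraticMap.linMulLin (x 0) (x 1) +
    E • QuadraticMap.linMulLin (x 1) (x 2) + F • QuadraticMap.linMulLin (x 2) (x 0), fun v => ?_⟩
  have hx i : x i (v ᵥ* M) = v i := by
    simp [x, vecMul_vecMul, mul_nonsing_inv _ (isUnit_iff_ne_zero.2 hM)]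
  simp only [_root_.add_apply, _root_.smul_apply, QuadraticMap.linMulLin_apply, hx,
    smul_eq_mul]
  ring

theorem exists_ne_zero_mem_coord_eq_zero {M : Matrix (Fin 3) (Fin 3) ℝ} (hM : M.det ≠ 0)
    {W : Submodule ℝ (Fin 3 → ℝ)} (hW : Module.finrank ℝ W = 2) (i : Fin 3) :
    ∃ u : Fin 3 → ℝ, u ≠ 0 ∧ u ᵥ* M ∈ W ∧ u i = 0 := by
  have h := LinearMap.ker_ne_bot_of_finrank_lt
    (f := (LinearMap.proj i ∘ₗ (M⁻¹).vecMulLinear : (Fin 3 → ℝ) →ₗ[ℝ] ℝ).domRestrict W)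
    (by rw [hW]; simp)
  obtain ⟨⟨w, hw⟩, hker, hne⟩ := (Submodule.ne_bot_iff _).1 h
  have e : (w ᵥ* M⁻¹) ᵥ* M = w := by
    rw [vecMul_vecMul, nonsing_inv_mul _ (isUnit_iff_ne_zero.2 hM), vecMul_one]
  refine ⟨w ᵥ* M⁻¹, fun h0 => hne ?_, e.symm ▸ hw, by simpa using hker⟩
  rw [h0, zero_vecMul] at e
  simp [← e]

theorem det_eq_zero_of_mem {M : Matrix (Fin 3) (Fin 3) ℝ} (hM : M.det ≠ 0)
    {W : Submodule ℝ (Fin 3 → ℝ)} (hW : Module.finrank ℝ W = 2) {u v w : Fin 3 → ℝ}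
    (hu : u ᵥ* M ∈ W) (hv : v ᵥ* M ∈ W) (hw : w ᵥ* M ∈ W) :
    (Matrix.of ![u, v, w]).det = 0 := by
  by_contra h
  have hd := det_of_smul_vecMul M 1 1 1 u v w
  simp only [one_smul, one_mul] at hd
  have hli : LinearIndependent ℝ ![u ᵥ* M, v ᵥ* M, w ᵥ* M] := by
    rw [linearIndependent_iff_det_ne_zero, hd]
    exact mul_ne_zero h hM
  have hli' : LinearIndependent ℝ (![⟨_, hu⟩, ⟨_, hv⟩, ⟨_, hw⟩] : Fin 3 → W) := by
    refine LinearIndependent.of_comp W.subtype ?_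
    convert hli using 1
    funext i
    fin_cases i <;> rfl
  have := hli'.fintype_card_le_finrank
  simp [hW] at this

theorem exists_ratio_mem_Ioo {x y r s : ℝ} (hrs : r < s) (h : (x + r * y) * (x + s * y) < 0) :
    ∃ b, r < b ∧ b < s ∧ y ≠ 0 ∧ x = -b * y := by
  have hy : y ≠ 0 := by
    rintro rfl
    nlinarith [mul_self_nonneg x]
  have hx : x = -(-x / y) * y := by field_simp
  have h' : (r - -x / y) * (s - -x / y) < 0 := by
    refine neg_of_mul_neg_right (a := y * y) ?_ (mul_self_nonneg y)
    have e : y * y * ((r - -x / y) * (s - -x / y)) = (x + r * y) * (x + s * y) := by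
      field_simp
      ring
    rw [e]
    exact h
  refine ⟨-x / y, ?_, ?_, hy, hx⟩
  · by_contra! hle
    nlinarith [mul_nonneg (sub_nonneg.2 hle) (sub_nonneg.2 (hle.trans hrs.le))]
  · by_contra! hle
    nlinarith [mul_nonneg (sub_nonneg.2 hle) (sub_nonneg.2 (hrs.le.trans hle))]

/-- Dominance of `p₁` forces the product of the parameters to be smaller than one. -/
theorem prod_lt_one_of_outsideConic {f : Fin 7 → RP2} {M : Matrix (Fin 3) (Fin 3) ℝ}
    {a : Fin 6 → ℝ} (hM : M.det ≠ 0) (hf : IsModel f M a) (hpos : ∀ i, 0 < a i) (h03 : a 0 < a 3)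
    (h21 : a 2 < a 1) (h45 : a 4 < a 5) (hlt : a 0 * a 1 * a 5 < 1)
    (hd : ∀ q : QuadraticForm ℝ (Fin 3 → ℝ), q ≠ 0 →
      (∀ j, j ≠ 0 → j ≠ 1 → q (f j).rep = 0) → OutsideConic q (f 1)) :
    a 0 * a 1 * a 2 * a 3 * a 4 * a 5 < 1 := by
  by_contra! hS
  have p0 := hpos 0
  have p1 := hpos 1
  have p2 := hpos 2
  have p3 := hpos 3
  have p4 := hpos 4
  have p5 := hpos 5
  obtain ⟨q, hq⟩ := exists_quadraticForm_vecMul hM (a 3) (a 1 * a 2 * a 4 * a 5 * a 3)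
    (a 4 * a 5 * a 3) (a 1 * a 2 * a 4 * a 5 * a 3 ^ 2 + 1) (a 4 * a 5 * a 3 * (a 1 + a 2))
    (a 3 * (a 4 + a 5))
  have hq0 : q ≠ 0 := by
    rintro rfl
    have := hq ![1, 0, 0]
    simp at this
    exact p3.ne this
  obtain ⟨L, ⟨W, hW, rfl⟩, hfW, hLW⟩ := hd q hq0 fun j hj0 hj1 => by
    obtain ⟨c, -, hrep⟩ := hf j
    rw [hrep, QuadraticMap.map_smul, hq]
    fin_cases j
    · exact absurd rfl hj0
    · exact absurd rfl hj1
    all_goals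
      simp [modelVec]
      right
      ring
  have hWq : ∀ w ∈ W, w ≠ 0 → q w ≠ 0 := fun w hw hw0 hqw => by
    obtain ⟨c, hc⟩ := exists_smul_eq_mk_rep ℝ w hw0
    have : mk ℝ w hw0 ∈ ({p : RP2 | p.rep ∈ W} ∩ ConicSet q : Set RP2) := by
      refine ⟨?_, ?_⟩
      · change (mk ℝ w hw0).rep ∈ W
        rw [← hc]
        exact W.smul_mem _ hw
      · change q (mk ℝ w hw0).rep = 0
        rw [← hc, Units.smul_def, QuadraticMap.map_smul, hqw, smul_zero]
    rw [hLW] at this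
    exact this
  have hpW : modelVec a 1 ᵥ* M ∈ W := by
    obtain ⟨c, hc, hrep⟩ := hf 1
    have : (f 1).rep ∈ W := hfW
    rw [hrep] at this
    exact (W.smul_mem_iff hc).1 this
  have hqp : q (modelVec a 1 ᵥ* M) < 0 := by
    refine (hWq _ hpW (vecMul_ne_zero_of_det_ne_zero hM (modelVec_ne_zero a 1))).lt_of_le ?_
    rw [hq]
    simp [modelVec]
    nlinarith [mul_nonneg (sub_nonneg.2 h03.le) (sub_nonneg.2 hS)]
  have hneg {u : Fin 3 → ℝ} (hu : u ᵥ* M ∈ W) (hu0 : u ≠ 0) : q (u ᵥ* M) < 0 :=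
    quadraticForm_neg_of_anisotropic hWq hpW hqp hu (vecMul_ne_zero_of_det_ne_zero hM hu0)
  obtain ⟨u, hu0, huW, hux⟩ := exists_ne_zero_mem_coord_eq_zero hM hW 0
  obtain ⟨v, hv0, hvW, hvy⟩ := exists_ne_zero_mem_coord_eq_zero hM hW 1
  have hqu := hneg huW hu0
  have hqv := hneg hvW hv0
  have hdet := det_eq_zero_of_mem hM hW hpW huW hvW
  rw [hq, hux] at hqu
  rw [hq, hvy] at hqv
  rw [det_fin_three] at hdet
  simp [modelVec, hux, hvy] at hdet
  have hu' : (u 2 + a 1 * u 1) * (u 2 + a 2 * u 1) < 0 := by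
    refine neg_of_mul_neg_right (a := a 4 * a 5 * a 3) ?_ (by positivity)
    linarith
  have hv' : (v 0 + a 4 * v 2) * (v 0 + a 5 * v 2) < 0 := by
    refine neg_of_mul_neg_right (a := a 3) ?_ (by positivity)
    linarith
  obtain ⟨b, hb, hb1, hu1, hu2⟩ := exists_ratio_mem_Ioo h21 ((mul_comm _ _).trans_lt hu')
  obtain ⟨c, hc, hc1, hv2, hv0⟩ := exists_ratio_mem_Ioo h45 hv'
  rw [hu2, hv0] at hdet
  have h1 : a 0 * b * c = 1 := by
    have : u 1 * v 2 * (1 - a 0 * b * c) = 0 := by linear_combination hdet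
    have := (mul_eq_zero.1 this).resolve_left (mul_ne_zero hu1 hv2)
    linarith
  have hb0 := p2.trans hb
  have hc0 := p4.trans hc
  have : a 0 * b * c ≤ a 0 * a 1 * a 5 := by gcongr
  linarith

end Dominance

section NormalForm

open Matrix

theorem exists_combination_of_mem_affLine {u v X Y : Fin 3 → ℝ} (hX : X ∈ AffLine u v)
    (hY : Y ∈ AffLine u v) (hXY : X ≠ Y) :
    (∃ α β : ℝ, u = α • X + β • Y) ∧ ∃ α β : ℝ, v = α • X + β • Y := by
  obtain ⟨s, rfl⟩ := hX
  obtain ⟨t, rfl⟩ := hY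
  have hst : s - t ≠ 0 := fun h => hXY (by rw [sub_eq_zero.1 h])
  refine ⟨⟨-t / (s - t), s / (s - t), ?_⟩, ⟨(1 - t) / (s - t), (s - 1) / (s - t), ?_⟩⟩
  · funext i
    simp
    field_simp
    ring
  · funext i
    simp
    field_simp
    ring

theorem mul_neg_of_octant {α β r s : ℝ} (hα : α ≠ 0) (hβ : β ≠ 0) (hs : s ≠ 0)
    (h : ∀ μ ν : ℝ, 0 < μ * α → 0 < μ * β + ν * r → 0 < ν * s → False) : α * β < 0 := by
  refine (mul_ne_zero hα hβ).lt_of_le (not_lt.1 fun hpos => ?_)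
  refine h (α * ((|s * r| + 1) / (α * β))) s ?_ ?_ (mul_self_pos.2 hs)
  · have := mul_self_pos.2 hα
    have : 0 < α * α * ((|s * r| + 1) / (α * β)) := by positivity
    linarith
  · have : α * ((|s * r| + 1) / (α * β)) * β = |s * r| + 1 := by field_simp
    rw [this]
    linarith [neg_abs_le (s * r)]

/-- A configuration whose points lie on the sides of the octant, at its centre, and off the
octant, is in normal form. -/
theorem exists_isModel_of_coords {f : Fin 7 → RP2} {M : Matrix (Fin 3) (Fin 3) ℝ}
    (hf : SimpleCfg f) {r : Fin 7 → ℝ} (hr : ∀ i, r i ≠ 0) {c : Fin 7 → Fin 3 → ℝ}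
    (hrep : ∀ i, (f i).rep = r i • (c i ᵥ* M)) (h0 : c 0 = ![1, 1, 1]) (h1 : c 1 2 = 0)
    (h4 : c 4 2 = 0) (h2 : c 2 0 = 0) (h3 : c 3 0 = 0) (h5 : c 5 1 = 0) (h6 : c 6 1 = 0)
    (hoct : ∀ v : Fin 3 → ℝ, (∀ k, 0 < v k) → ∀ i j : Fin 7, i ≠ 0 → j ≠ 0 → i ≠ j →
      v ᵥ* M ∉ Submodule.span ℝ ({(f i).rep, (f j).rep} : Set (Fin 3 → ℝ))) :
    ∃ a : Fin 6 → ℝ, (∀ i, 0 < a i) ∧ IsModel f M a := by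
  have hdet (i j k : Fin 7) (hij : i ≠ j) (hik : i ≠ k) (hjk : j ≠ k) :
      (Matrix.of ![c i, c j, c k]).det ≠ 0 := by
    have := not_not.1 (hf.2 i j k hij hik hjk)
    rw [linearIndependent_iff_det_ne_zero, hrep i, hrep j, hrep k, det_of_smul_vecMul] at this
    exact right_ne_zero_of_mul (left_ne_zero_of_mul this)
  have oct (i j : Fin 7) (hi : i ≠ 0) (hj : j ≠ 0) (hij : i ≠ j) (μ ν : ℝ)
      (p0 : 0 < μ * c i 0 + ν * c j 0) (p1 : 0 < μ * c i 1 + ν * c j 1)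
      (p2 : 0 < μ * c i 2 + ν * c j 2) : False := by
    refine hoct (μ • c i + ν • c j) ?_ i j hi hj hij ?_
    · intro k
      fin_cases k
      exacts [p0, p1, p2]
    · rw [Submodule.mem_span_pair]
      refine ⟨μ / r i, ν / r j, ?_⟩
      rw [hrep i, hrep j, smul_smul, smul_smul, div_mul_cancel₀ _ (hr i),
        div_mul_cancel₀ _ (hr j), add_vecMul, smul_vecMul, smul_vecMul]
  have d123 := hdet 1 2 3 (by decide) (by decide) (by decide)
  have d423 := hdet 4 2 3 (by decide) (by decide) (by decide)
  have d156 := hdet 1 5 6 (by decide) (by decide) (by decide)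
  have d456 := hdet 4 5 6 (by decide) (by decide) (by decide)
  have d214 := hdet 2 1 4 (by decide) (by decide) (by decide)
  have d314 := hdet 3 1 4 (by decide) (by decide) (by decide)
  have d256 := hdet 2 5 6 (by decide) (by decide) (by decide)
  have d356 := hdet 3 5 6 (by decide) (by decide) (by decide)
  have d514 := hdet 5 1 4 (by decide) (by decide) (by decide)
  have d614 := hdet 6 1 4 (by decide) (by decide) (by decide)
  have d523 := hdet 5 2 3 (by decide) (by decide) (by decide)
  have d623 := hdet 6 2 3 (by decide) (by decide) (by decide)
  rw [det_fin_three] at d123 d423 d156 d456 d214 d314 d256 d356 d514 d614 d523 d623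
  simp [h1, h2, h3, h4, h5, h6] at d123 d423 d156 d456 d214 d314 d256 d356 d514 d614 d523 d623
  have n10 : c 1 0 ≠ 0 := by rintro h; simp [h] at d123
  have n40 : c 4 0 ≠ 0 := by rintro h; simp [h] at d423
  have n11 : c 1 1 ≠ 0 := by rintro h; simp [h] at d156
  have n41 : c 4 1 ≠ 0 := by rintro h; simp [h] at d456
  have n21 : c 2 1 ≠ 0 := by rintro h; simp [h] at d256
  have n31 : c 3 1 ≠ 0 := by rintro h; simp [h] at d356
  have n22 : c 2 2 ≠ 0 := by rintro h; simp [h] at d214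
  have n32 : c 3 2 ≠ 0 := by rintro h; simp [h] at d314
  have n52 : c 5 2 ≠ 0 := by rintro h; simp [h] at d514
  have n62 : c 6 2 ≠ 0 := by rintro h; simp [h] at d614
  have n50 : c 5 0 ≠ 0 := by rintro h; simp [h] at d523
  have n60 : c 6 0 ≠ 0 := by rintro h; simp [h] at d623
  have s1 : c 1 0 * c 1 1 < 0 := mul_neg_of_octant (r := c 2 1) n10 n11 n22 fun μ ν x y z =>
    oct 1 2 (by decide) (by decide) (by decide) μ ν (by simpa [h2]) y (by simpa [h1])
  have s4 : c 4 0 * c 4 1 < 0 := mul_neg_of_octant (r := c 2 1) n40 n41 n22 fun μ ν x y z =>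
    oct 4 2 (by decide) (by decide) (by decide) μ ν (by simpa [h2]) y (by simpa [h4])
  have s2 : c 2 1 * c 2 2 < 0 := mul_neg_of_octant (r := c 5 2) n21 n22 n50 fun μ ν x y z =>
    oct 2 5 (by decide) (by decide) (by decide) μ ν (by simpa [h2]) (by simpa [h5]) y
  have s3 : c 3 1 * c 3 2 < 0 := mul_neg_of_octant (r := c 5 2) n31 n32 n50 fun μ ν x y z =>
    oct 3 5 (by decide) (by decide) (by decide) μ ν (by simpa [h3]) (by simpa [h5]) y
  have s5 : c 5 2 * c 5 0 < 0 := mul_neg_of_octant (r := c 1 0) n52 n50 n11 fun μ ν x y z =>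
    oct 5 1 (by decide) (by decide) (by decide) μ ν y (by simpa [h5]) (by simpa [h1])
  have s6 : c 6 2 * c 6 0 < 0 := mul_neg_of_octant (r := c 1 0) n62 n60 n11 fun μ ν x y z =>
    oct 6 1 (by decide) (by decide) (by decide) μ ν y (by simpa [h6]) (by simpa [h1])
  have pos {x y : ℝ} (h : x * y < 0) : 0 < -y / x := by
    have : x ≠ 0 := by rintro rfl; simp at h
    have e : -y / x = -(x * y) / (x * x) := by field_simp
    rw [e]
    exact div_pos (neg_pos.2 h) (mul_self_pos.2 this)
  let a : Fin 6 → ℝ := ![-c 1 1 / c 1 0, -c 2 2 / c 2 1, -c 3 2 / c 3 1, -c 4 1 / c 4 0,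
    -c 5 0 / c 5 2, -c 6 0 / c 6 2]
  refine ⟨a, ?_, fun i => ?_⟩
  · intro i
    fin_cases i
    exacts [pos s1, pos s2, pos s3, pos s4, pos s5, pos s6]
  · let d : Fin 7 → ℝ := ![1, c 1 0, c 2 1, c 3 1, c 4 0, c 5 2, c 6 2]
    have hd : d i ≠ 0 := by
      fin_cases i
      exacts [one_ne_zero, n10, n21, n31, n40, n52, n62]
    refine ⟨r i * d i, mul_ne_zero (hr i) hd, ?_⟩
    have e : c i = d i • modelVec a i := by
      funext k
      fin_cases i <;> fin_cases k <;> simp [d, a, modelVec, *] <;> field_simp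
    rw [hrep i, e, smul_vecMul, smul_smul]

/-- The signs in the normal form of a consecutively labeled hexagon, up to a global sign. -/
theorem signs_of_edges {a s : Fin 6 → ℝ} (hpos : ∀ i, 0 < a i) (hs : 0 < s 0)
    (he : ∀ i : Fin 6, ∃ h : Fin 3 → ℝ, h ⬝ᵥ modelVec a i.succ = 0 ∧
      h ⬝ᵥ modelVec a (i + 1).succ = 0 ∧
      ∀ j, j ≠ i → j ≠ i + 1 → s j * (h ⬝ᵥ modelVec a j.succ) < 0) :
    (a 0 < a 3 ∧ a 2 < a 1 ∧ a 4 < a 5 ∧ a 0 * a 1 * a 5 < 1 ∧ 1 < a 3 * a 2 * a 4) ∨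
      (a 3 < a 0 ∧ a 1 < a 2 ∧ a 5 < a 4 ∧ 1 < a 0 * a 1 * a 5 ∧ a 3 * a 2 * a 4 < 1) := by
  have p0 := hpos 0
  have p1 := hpos 1
  have p2 := hpos 2
  have p3 := hpos 3
  have p4 := hpos 4
  have p5 := hpos 5
  obtain ⟨h, h0, h1, hj⟩ := he 0
  obtain ⟨k, k0, k1, kj⟩ := he 3
  obtain ⟨l, l0, l1, lj⟩ := he 1
  obtain ⟨m, m0, m1, mj⟩ := he 4
  have hj2 := hj 2 (by decide) (by decide)
  have hj3 := hj 3 (by decide) (by decide)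
  have hj4 := hj 4 (by decide) (by decide)
  have hj5 := hj 5 (by decide) (by decide)
  have kj5 := kj 5 (by decide) (by decide)
  have kj0 := kj 0 (by decide) (by decide)
  have kj1 := kj 1 (by decide) (by decide)
  have kj2 := kj 2 (by decide) (by decide)
  have lj0 := lj 0 (by decide) (by decide)
  have lj3 := lj 3 (by decide) (by decide)
  have lj4 := lj 4 (by decide) (by decide)
  have lj5 := lj 5 (by decide) (by decide)
  have mj0 := mj 0 (by decide) (by decide)
  have mj1 := mj 1 (by decide) (by decide)
  have mj2 := mj 2 (by decide) (by decide)
  clear he hj kj lj mj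
  simp [modelVec, dotProduct, Fin.sum_univ_three] at h0 h1 k0 k1 l0 l1 m0 m1
  simp [modelVec, dotProduct, Fin.sum_univ_three] at hj2 hj3 hj4 hj5 kj5 kj0 kj1 kj2
  simp [modelVec, dotProduct, Fin.sum_univ_three] at lj0 lj3 lj4 lj5 mj0 mj1 mj2
  have e1 : h 1 = h 2 * a 1 := by linarith
  have e0 : h 0 = h 2 * a 1 * a 0 := by rw [← e1]; linarith
  have f0 : k 0 = k 1 * a 3 := by linarith
  have f2 : k 2 = k 1 * a 3 * a 4 := by rw [← f0]; linarith
  have n12 : a 1 ≠ a 2 := by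
    intro e
    rw [e1, e] at hj2
    simp at hj2
  have n45 : a 4 ≠ a 5 := by
    intro e
    rw [f2, f0, e] at kj5
    simp at kj5
  have l2 : l 2 = 0 := by
    have : l 2 * (a 1 - a 2) = 0 := by linarith
    simpa [sub_eq_zero, n12] using this
  have m0' : m 0 = 0 := by
    have : m 0 * (a 4 - a 5) = 0 := by linarith
    simpa [sub_eq_zero, n45] using this
  simp [l2] at l0
  simp [m0'] at m0
  simp only [l0, l2, m0, m0', zero_mul, neg_zero, add_zero, zero_add] at lj0 lj3 lj4 lj5 mj0 mj1 mj2
  have l0neg : l 0 < 0 := neg_of_mul_neg_right lj0 hs.le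
  have m1pos : 0 < m 1 := by
    refine pos_of_mul_pos_left (b := a 0) (neg_neg_iff_pos.1 ?_) p0.le
    exact neg_of_mul_neg_right mj0 hs.le
  have s3 : 0 < s 3 := pos_of_mul_neg_left lj3 l0neg.le
  have s4 : s 4 < 0 := neg_of_mul_neg_left lj4 (neg_nonneg.2 (mul_neg_of_neg_of_pos l0neg p4).le)
  have s5 : s 5 < 0 := neg_of_mul_neg_left lj5 (neg_nonneg.2 (mul_neg_of_neg_of_pos l0neg p5).le)
  have s1 : s 1 < 0 := neg_of_mul_neg_left mj1 m1pos.le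
  have s2 : s 2 < 0 := neg_of_mul_neg_left mj2 m1pos.le
  have neg_of {x y z : ℝ} (hx : 0 < x) (h : x * y < 0) (e : y = z) : z < 0 := by
    rw [← e]
    exact neg_of_mul_neg_right h hx.le
  have pos_of {x y z : ℝ} (hx : x < 0) (h : x * y < 0) (e : y = z) : 0 < z := by
    rw [← e]
    exact pos_of_mul_neg_right h hx.le
  have A2 := pos_of s2 hj2 (z := h 2 * (a 1 - a 2)) (by rw [e1]; ring)
  have A3 := neg_of p1 (neg_of s3 hj3 (z := a 1 * (h 2 * (a 0 - a 3)))
    (by rw [e0, e1]; ring)) rfl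
  have A5 := pos_of s5 hj5 (z := h 2 * (1 - a 0 * a 1 * a 5)) (by rw [e0]; ring)
  have B5 := pos_of s5 kj5 (z := a 3 * (k 1 * (a 4 - a 5))) (by rw [f2, f0]; ring)
  have B2 := pos_of s2 kj2 (z := k 1 * (1 - a 3 * a 2 * a 4)) (by rw [f2]; ring)
  have B0 := neg_of hs kj0 (z := k 1 * (a 3 - a 0)) (by rw [f0]; ring)
  replace B5 := pos_of_mul_pos_right B5 p3.le
  rcases lt_trichotomy (h 2) 0 with hh | hh | hh
  · have c1 := sub_neg.1 (neg_of_mul_pos_right A2 hh.le)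
    have c2 := sub_pos.1 (pos_of_mul_neg_right A3 hh.le)
    have c3 := sub_neg.1 (neg_of_mul_pos_right A5 hh.le)
    have hk : 0 < k 1 := pos_of_mul_neg_left B0 (by linarith)
    have c4 := sub_pos.1 (pos_of_mul_pos_right B5 hk.le)
    have c5 := sub_pos.1 (pos_of_mul_pos_right B2 hk.le)
    exact Or.inr ⟨c2, c1, c4, c3, c5⟩
  · simp [hh] at A2
  · have c1 := sub_pos.1 (pos_of_mul_pos_right A2 hh.le)
    have c2 := sub_neg.1 (neg_of_mul_neg_right A3 hh.le)
    have c3 := sub_pos.1 (pos_of_mul_pos_right A5 hh.le)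
    have hk : k 1 < 0 := neg_of_mul_neg_left B0 (by linarith)
    have c4 := sub_neg.1 (neg_of_mul_pos_right B5 hk.le)
    have c5 := sub_neg.1 (neg_of_mul_pos_right B2 hk.le)
    exact Or.inl ⟨c2, c1, c4, c3, c5⟩

end NormalForm

section TypeFNormalForm

open Matrix

theorem chart_eq_of_rep_eq {φ : (Fin 3 → ℝ) →ₗ[ℝ] ℝ} {p : RP2} {c : ℝ} {v : Fin 3 → ℝ}
    (h : p.rep = c • v) : chart φ p = ((φ p.rep)⁻¹ * c) • v := by
  rw [mul_smul, ← h, chart]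

theorem apply_chart {φ : (Fin 3 → ℝ) →ₗ[ℝ] ℝ} {p : RP2} (h : φ p.rep ≠ 0) :
    φ (chart φ p) = 1 := by
  rw [chart, map_smul, smul_eq_mul, inv_mul_cancel₀ h]

theorem dotProduct_apply_rows (χ : (Fin 3 → ℝ) →ₗ[ℝ] ℝ) (M : Matrix (Fin 3) (Fin 3) ℝ)
    (v : Fin 3 → ℝ) : (fun k => χ (M k)) ⬝ᵥ v = χ (v ᵥ* M) := by
  rw [vecMul_eq_sum, map_sum]
  simp [dotProduct, mul_comm]

theorem signs_of_consecWith {f : Fin 7 → RP2} {M : Matrix (Fin 3) (Fin 3) ℝ} {a : Fin 6 → ℝ}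
    {φ : (Fin 3 → ℝ) →ₗ[ℝ] ℝ} (hf : IsModel f M a) (hpos : ∀ i, 0 < a i)
    (hφ : ConsecWith φ (fun i : Fin 6 => f i.succ)) :
    (a 0 < a 3 ∧ a 2 < a 1 ∧ a 4 < a 5 ∧ a 0 * a 1 * a 5 < 1 ∧ 1 < a 3 * a 2 * a 4) ∨
      (a 3 < a 0 ∧ a 1 < a 2 ∧ a 5 < a 4 ∧ 1 < a 0 * a 1 * a 5 ∧ a 3 * a 2 * a 4 < 1) := by
  choose c hc hrep using hf
  obtain ⟨⟨-, hne, -⟩, hedge⟩ := hφ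
  let s : Fin 6 → ℝ := fun j => (φ (f j.succ).rep)⁻¹ * c j.succ
  have hs (j : Fin 6) : s j ≠ 0 := mul_ne_zero (inv_ne_zero (hne j)) (hc j.succ)
  have hchart (j : Fin 6) : chart φ (f j.succ) = s j • (modelVec a j.succ ᵥ* M) :=
    chart_eq_of_rep_eq (hrep j.succ)
  have he (i : Fin 6) : ∃ h : Fin 3 → ℝ, h ⬝ᵥ modelVec a i.succ = 0 ∧
      h ⬝ᵥ modelVec a (i + 1).succ = 0 ∧
      ∀ j, j ≠ i → j ≠ i + 1 → s j * (h ⬝ᵥ modelVec a j.succ) < 0 := by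
    obtain ⟨ψ, h1, h2⟩ := hedge i
    let χ := ψ - ψ (chart φ (f i.succ)) • φ
    have key (j : Fin 6) : s j * ((fun k => χ (M k)) ⬝ᵥ modelVec a j.succ) =
        ψ (chart φ (f j.succ)) - ψ (chart φ (f i.succ)) := by
      rw [dotProduct_apply_rows, ← smul_eq_mul, ← map_smul, ← hchart]
      simp [χ, apply_chart (hne j)]
    refine ⟨fun k => χ (M k), ?_, ?_, fun j hj hj' => ?_⟩
    · have := key i
      rw [sub_self] at this
      exact (mul_eq_zero.1 this).resolve_left (hs i)
    · have := key (i + 1)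
      rw [← h1, sub_self] at this
      exact (mul_eq_zero.1 this).resolve_left (hs _)
    · rw [key]
      exact sub_neg.2 (h2 j hj hj')
  rcases (hs 0).lt_or_gt with h0 | h0
  · refine signs_of_edges hpos (s := -s) (neg_pos.2 h0) fun i => ?_
    obtain ⟨h, h1, h2, h3⟩ := he i
    refine ⟨-h, by simp [h1], by simp [h2], fun j hj hj' => ?_⟩
    simpa using h3 j hj hj'
  · exact signs_of_edges hpos h0 he

theorem exists_isModel_of_typeF {f : Fin 7 → RP2} (hf : TypeF f) :
    ∃ (M : Matrix (Fin 3) (Fin 3) ℝ) (a : Fin 6 → ℝ), M.det ≠ 0 ∧ (∀ i, 0 < a i) ∧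
      IsModel f M a := by
  obtain ⟨htyp, φ, ⟨⟨-, hne, -⟩, -⟩, -, A, B, C, hA, hA', hB, hB', hC, hC', hABC, h0, hdisj⟩ := hf
  have hφ (j : Fin 7) (hj : j ≠ 0) : φ (f j).rep ≠ 0 := by
    obtain ⟨i, rfl⟩ := Fin.exists_succ_eq.2 hj
    exact hne i
  have hline {u v x : Fin 3 → ℝ} (hx : x ∈ AffLine u v) (hu : φ u = 1) (hv : φ v = 1) :
      φ x = 1 := by
    obtain ⟨t, rfl⟩ := hx
    simp [hu, hv]
  have hφA : φ A = 1 :=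
    hline hA (apply_chart (hφ 1 (by decide))) (apply_chart (hφ 4 (by decide)))
  have hφB : φ B = 1 :=
    hline hB (apply_chart (hφ 2 (by decide))) (apply_chart (hφ 3 (by decide)))
  have hφC : φ C = 1 :=
    hline hC (apply_chart (hφ 5 (by decide))) (apply_chart (hφ 6 (by decide)))
  have hAB : A ≠ B := hABC.injective.ne (show (0 : Fin 3) ≠ 1 by decide)
  have hBC : B ≠ C := hABC.injective.ne (show (1 : Fin 3) ≠ 2 by decide)
  have hCA : C ≠ A := hABC.injective.ne (show (2 : Fin 3) ≠ 0 by decide)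
  obtain ⟨α, β, γ, hα, hβ, hγ, hsum, hx⟩ := h0
  let M : Matrix (Fin 3) (Fin 3) ℝ := Matrix.of ![γ • C, α • A, β • B]
  have hvM (v : Fin 3 → ℝ) : v ᵥ* M = (v 0 * γ) • C + (v 1 * α) • A + (v 2 * β) • B := by
    rw [vecMul_eq_sum, Fin.sum_univ_three]
    rw [mul_smul, mul_smul, mul_smul]
    rfl
  have hM : M.det ≠ 0 := by
    intro hdet
    obtain ⟨v, hv, hv0⟩ := exists_vecMul_eq_zero_iff.2 hdet
    rw [hvM] at hv0
    have hw := hABC.eq_zero_of_sum_eq_zero (s := Finset.univ)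
      (w := ![v 1 * α, v 2 * β, v 0 * γ]) ?_ ?_
    · refine hv (funext fun k => ?_)
      have w0 := hw 0 (Finset.mem_univ _)
      have w1 := hw 1 (Finset.mem_univ _)
      have w2 := hw 2 (Finset.mem_univ _)
      simp [hα.ne', hβ.ne', hγ.ne'] at w0 w1 w2
      fin_cases k
      exacts [w2, w0, w1]
    · have := congrArg φ hv0
      simp [hφA, hφB, hφC] at this
      simp [Fin.sum_univ_three]
      linarith
    · rw [← hv0]
      simp [Fin.sum_univ_three]
      abel
  have hrep0 : φ (f 0).rep ≠ 0 := by
    intro h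
    have : φ (chart φ (f 0)) = 1 := by
      rw [hx]
      simp [hφA, hφB, hφC, hsum]
    simp [chart, h] at this
  have hr (i : Fin 7) : φ (f i).rep ≠ 0 := by
    rcases eq_or_ne i 0 with rfl | hi
    exacts [hrep0, hφ i hi]
  have hrep (i : Fin 7) : (f i).rep = φ (f i).rep • chart φ (f i) := by
    rw [chart, smul_smul, mul_inv_cancel₀ (hr i), one_smul]
  obtain ⟨⟨x1, y1, e1⟩, x4, y4, e4⟩ := exists_combination_of_mem_affLine hC' hA hCA
  obtain ⟨⟨x2, y2, e2⟩, x3, y3, e3⟩ := exists_combination_of_mem_affLine hA' hB hAB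
  obtain ⟨⟨x5, y5, e5⟩, x6, y6, e6⟩ := exists_combination_of_mem_affLine hB' hC hBC
  let c : Fin 7 → Fin 3 → ℝ := ![![1, 1, 1], ![x1 / γ, y1 / α, 0], ![0, x2 / α, y2 / β],
    ![0, x3 / α, y3 / β], ![x4 / γ, y4 / α, 0], ![y5 / γ, 0, x5 / β], ![y6 / γ, 0, x6 / β]]
  have hc (i : Fin 7) : chart φ (f i) = c i ᵥ* M := by
    rw [hvM]
    fin_cases i
    · simp [c, hx]
      abel
    · simpa [c, hα.ne', hβ.ne', hγ.ne'] using e1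
    · simpa [c, hα.ne', hβ.ne', hγ.ne'] using e2
    · simpa [c, hα.ne', hβ.ne', hγ.ne'] using e3
    · simpa [c, hα.ne', hβ.ne', hγ.ne'] using e4
    · simpa [c, hα.ne', hβ.ne', hγ.ne', add_comm] using e5
    · simpa [c, hα.ne', hβ.ne', hγ.ne', add_comm] using e6
  obtain ⟨a, ha, hfa⟩ := exists_isModel_of_coords htyp.1 hr (c := c) (M := M)
    (fun i => by rw [← hc, ← hrep]) rfl rfl rfl rfl rfl rfl rfl fun v hv i j hi hj hij hmem => by
      have p : 0 < v 1 * α + v 2 * β + v 0 * γ := by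
        have := hv 0
        have := hv 1
        have := hv 2
        positivity
      refine hdisj i j hi hj hij ((v 1 * α + v 2 * β + v 0 * γ)⁻¹ • v ᵥ* M) ?_
        (Submodule.smul_mem _ _ hmem)
      refine ⟨(v 1 * α + v 2 * β + v 0 * γ)⁻¹ * (v 1 * α),
        (v 1 * α + v 2 * β + v 0 * γ)⁻¹ * (v 2 * β),
        (v 1 * α + v 2 * β + v 0 * γ)⁻¹ * (v 0 * γ), ?_, ?_, ?_, ?_, ?_⟩
      · exact mul_pos (inv_pos.2 p) (mul_pos (hv 1) hα)
      · exact mul_pos (inv_pos.2 p) (mul_pos (hv 2) hβ)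
      · exact mul_pos (inv_pos.2 p) (mul_pos (hv 0) hγ)
      · rw [← mul_add, ← mul_add, inv_mul_cancel₀ p.ne']
      · rw [hvM, smul_add, smul_add, smul_smul, smul_smul, smul_smul]
        abel
  exact ⟨M, a, hM, ha, hfa⟩

end TypeFNormalForm
section Reflection

open Matrix

/-- The parameters of the mirror image of a normal form. -/
def reflectParams (a : Fin 6 → ℝ) : Fin 6 → ℝ :=
  ![(a 0)⁻¹, (a 5)⁻¹, (a 4)⁻¹, (a 3)⁻¹, (a 2)⁻¹, (a 1)⁻¹]

/-- The relabeling reversing the cyclic order of the hexagon `p₁, …, p₆` and fixing `p₁`. -/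
def reflectPerm : Equiv.Perm (Fin 7) := Equiv.swap 2 6 * Equiv.swap 3 5

theorem isModel_reflect {f : Fin 7 → RP2} {M : Matrix (Fin 3) (Fin 3) ℝ} {a : Fin 6 → ℝ}
    (hf : IsModel f M a) (hpos : ∀ i, 0 < a i) :
    IsModel (f ∘ reflectPerm) (Matrix.of ![M 1, M 0, M 2]) (reflectParams a) := by
  have n (i : Fin 6) : a i ≠ 0 := (hpos i).ne'
  have key (i : Fin 7) : modelVec a (reflectPerm i) ᵥ* M =
      (![1, -a 0, -a 5, -a 4, -a 3, -a 2, -a 1] : Fin 7 → ℝ) i •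
        (modelVec (reflectParams a) i ᵥ* Matrix.of ![M 1, M 0, M 2]) := by
    funext k
    fin_cases i <;>
      simp [reflectPerm, Equiv.swap_apply_def, modelVec, reflectParams, vecMul, dotProduct,
        Fin.sum_univ_three, n, mul_add, ← mul_assoc] <;> ring
  intro i
  obtain ⟨c, hc, h⟩ := hf (reflectPerm i)
  rw [key, smul_smul] at h
  refine ⟨_, mul_ne_zero hc ?_, h⟩
  fin_cases i <;> simp [n]

theorem exists_chamber_isModel {f : Fin 7 → RP2} (hf : TypeF f) :
    ∃ (σ : Equiv.Perm (Fin 7)) (M : Matrix (Fin 3) (Fin 3) ℝ) (a : Fin 6 → ℝ),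
      0 < M.det ∧ Chamber a ∧ IsModel (f ∘ σ) M a := by
  suffices H : ∃ (σ : Equiv.Perm (Fin 7)) (M : Matrix (Fin 3) (Fin 3) ℝ) (a : Fin 6 → ℝ),
      M.det ≠ 0 ∧ Chamber a ∧ IsModel (f ∘ σ) M a by
    obtain ⟨σ, M, a, hM, ha, h⟩ := H
    rcases hM.lt_or_gt with hM | hM
    · refine ⟨σ, -M, a, by simpa [det_neg, Odd.neg_one_pow (by decide : Odd 3)] using hM, ha,
        fun i => ?_⟩
      obtain ⟨c, hc, h⟩ := h i
      exact ⟨-c, neg_ne_zero.2 hc, by rw [h, vecMul_neg, neg_smul_neg]⟩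
    · exact ⟨σ, M, a, hM, ha, h⟩
  obtain ⟨M, a, hM, hpos, hmodel⟩ := exists_isModel_of_typeF hf
  obtain ⟨-, φ, hφ, hdom, -⟩ := hf
  have hd (q : QuadraticForm ℝ (Fin 3 → ℝ)) (hq : q ≠ 0)
      (h : ∀ j, j ≠ 0 → j ≠ 1 → q (f j).rep = 0) : OutsideConic q (f 1) :=
    hdom q hq fun j hj => h j.succ (Fin.succ_ne_zero j) fun e => hj (Fin.succ_injective _ e)
  rcases signs_of_consecWith hmodel hpos hφ with ⟨h03, h21, h45, hlt, hgt⟩ |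
    ⟨h03, h21, h45, hlt, hgt⟩
  · exact ⟨1, M, a, hM, ⟨hpos, h03, h21, h45, hlt, hgt,
      prod_lt_one_of_outsideConic hM hmodel hpos h03 h21 h45 hlt hd⟩, hmodel⟩
  · have hmodel' := isModel_reflect hmodel hpos
    have hM' : (Matrix.of ![M 1, M 0, M 2]).det ≠ 0 := by
      rw [det_fin_three] at hM ⊢
      contrapose! hM
      simp at hM
      linarith
    have hpos' (i : Fin 6) : 0 < reflectParams a i := by
      fin_cases i <;> exact inv_pos.2 (hpos _)
    have h03' : reflectParams a 0 < reflectParams a 3 := inv_strictAnti₀ (hpos 3) h03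
    have h21' : reflectParams a 2 < reflectParams a 1 := inv_strictAnti₀ (hpos 5) h45
    have h45' : reflectParams a 4 < reflectParams a 5 := inv_strictAnti₀ (hpos 1) h21
    have hlt' : reflectParams a 0 * reflectParams a 1 * reflectParams a 5 < 1 := by
      have := inv_lt_one_of_one_lt₀ hlt
      rw [mul_inv, mul_inv] at this
      refine lt_of_eq_of_lt ?_ this
      simp [reflectParams]
      ring
    have hgt' : 1 < reflectParams a 3 * reflectParams a 2 * reflectParams a 4 := by
      have p := mul_pos (mul_pos (hpos 3) (hpos 2)) (hpos 4)
      have := one_lt_inv_iff₀.2 ⟨p, hgt⟩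
      rw [mul_inv, mul_inv] at this
      refine lt_of_lt_of_eq this ?_
      simp [reflectParams]
      ring
    refine ⟨reflectPerm, _, _, hM', ⟨hpos', h03', h21', h45', hlt', hgt', ?_⟩, hmodel'⟩
    refine prod_lt_one_of_outsideConic hM' hmodel' hpos' h03' h21' h45' hlt' fun q hq h => ?_
    refine hd q hq fun j hj hj' => ?_
    have e : reflectPerm (reflectPerm j) = j := by
      revert j
      decide
    rw [← e]
    refine h (reflectPerm j) ?_ ?_
    · revert j
      decide
    · revert j
      decide

end Reflection

section Deformation

open Matrix

theorem eq_mk_of_rep_eq {p : RP2} {c : ℝ} {v : Fin 3 → ℝ} (hv : v ≠ 0) (h : p.rep = c • v) :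
    p = Projectivization.mk ℝ v hv := by
  rw [← p.mk_rep, Projectivization.mk_eq_mk_iff']
  exact ⟨c, h.symm⟩

theorem continuous_mk {T : Type*} [TopologicalSpace T] {v : T → Fin 3 → ℝ} (hv : Continuous v)
    (h0 : ∀ t, v t ≠ 0) : Continuous fun t => (Projectivization.mk ℝ (v t) (h0 t) : RP2) :=
  continuous_quotient_mk'.comp (hv.subtype_mk h0)

theorem continuous_modelVec (i : Fin 7) : Continuous fun a => modelVec a i := by
  refine continuous_pi fun k => ?_
  fin_cases i <;> fin_cases k <;> simp [modelVec] <;> fun_prop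

theorem joinedIn_chamber {a b : Fin 6 → ℝ} (ha : Chamber a) (hb : Chamber b) :
    JoinedIn {a | Chamber a} a b := by
  let u (t : ℝ) (i : Fin 6) : ℝ := (1 - t) * Real.log (a i) + t * Real.log (b i)
  have hexp (x : ℝ) (hx : 0 < x) : Real.exp (Real.log x) = x := Real.exp_log hx
  refine JoinedIn.ofLine (f := fun t i => Real.exp (u t i)) ?_ ?_ ?_ ?_
  · refine Continuous.continuousOn ?_
    fun_prop
  · funext i
    simp [u, hexp _ (ha.1 i)]
  · funext i
    simp [u, hexp _ (hb.1 i)]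
  · rintro - ⟨t, ht, rfl⟩
    have chamber_iff (c : Fin 6 → ℝ) : Chamber (fun i => Real.exp (c i)) ↔
        0 < c 3 - c 0 ∧ 0 < c 1 - c 2 ∧ 0 < c 5 - c 4 ∧ 0 < -(c 0 + c 1 + c 5) ∧
          0 < c 3 + c 2 + c 4 ∧ 0 < -(c 0 + c 1 + c 2 + c 3 + c 4 + c 5) := by
      simp only [Chamber, ← Real.exp_add, Real.exp_lt_exp, Real.exp_lt_one_iff, sub_pos, neg_pos,
        Real.one_lt_exp_iff]
      simp [Real.exp_pos]
    have e (x : Fin 6 → ℝ) (hx : Chamber x) : (fun i => Real.exp (Real.log (x i))) = x :=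
      funext fun i => hexp _ (hx.1 i)
    obtain ⟨a1, a2, a3, a4, a5, a6⟩ := (chamber_iff fun i => Real.log (a i)).1 (by rwa [e a ha])
    obtain ⟨b1, b2, b3, b4, b5, b6⟩ := (chamber_iff fun i => Real.log (b i)).1 (by rwa [e b hb])
    refine (chamber_iff _).2 ⟨?_, ?_, ?_, ?_, ?_, ?_⟩
    · exact (combo_pos ht a1 b1).trans_eq (by ring)
    · exact (combo_pos ht a2 b2).trans_eq (by ring)
    · exact (combo_pos ht a3 b3).trans_eq (by ring)
    · exact (combo_pos ht a4 b4).trans_eq (by ring)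
    · exact (combo_pos ht a5 b5).trans_eq (by ring)
    · exact (combo_pos ht a6 b6).trans_eq (by ring)

end Deformation

/-- Any two typical 7-configurations of type F can be joined by a Q-deformation: they form
a single Q-deformation class. -/
theorem typeF_single_qdeformation_class
    (f g : Fin 7 → RP2) (hf : TypeF f) (hg : TypeF g) :
    ∃ γ : Fin 7 → unitInterval → RP2, QDeformFam 7 γ ∧
      (Set.range fun i => γ i 0) = Set.range f ∧
      (Set.range fun i => γ i 1) = Set.range g := by
  obtain ⟨σ, M, a, hM, ha, hfa⟩ := exists_chamber_isModel hf
  obtain ⟨τ, N, b, hN, hb, hgb⟩ := exists_chamber_isModel hg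
  have hMN := joinedIn_det_pos hM hN
  have hab := joinedIn_chamber ha hb
  have hdet (t : unitInterval) : (hMN.somePath t).det ≠ 0 := (hMN.somePath_mem t).ne'
  have hne (i : Fin 7) (t : unitInterval) :
      Matrix.vecMul (modelVec (hab.somePath t) i) (hMN.somePath t) ≠ 0 :=
    vecMul_ne_zero_of_det_ne_zero (hdet t) (modelVec_ne_zero _ i)
  let γ : Fin 7 → unitInterval → RP2 := fun i t => Projectivization.mk ℝ _ (hne i t)
  have hrange (h : Fin 7 → RP2) (ρ : Equiv.Perm (Fin 7)) (t : unitInterval)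
      (hρ : IsModel (h ∘ ρ) (hMN.somePath t) (hab.somePath t)) :
      (Set.range fun i => γ i t) = Set.range h := by
    rw [← ρ.surjective.range_comp h]
    congr 1
    funext i
    obtain ⟨c, -, hc⟩ := hρ i
    exact (eq_mk_of_rep_eq (hne i t) hc).symm
  refine ⟨γ, ⟨fun i => ?_, fun t => ?_⟩, hrange f σ 0 ?_, hrange g τ 1 ?_⟩
  · refine continuous_mk ?_ _
    exact Continuous.matrix_vecMul ((continuous_modelVec i).comp hab.somePath.continuous)
      hMN.somePath.continuous
  · refine typicalCfg_of_isModel (hdet t) (hab.somePath_mem t) fun i => ?_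
    obtain ⟨c, hc⟩ := Projectivization.exists_smul_eq_mk_rep ℝ _ (hne i t)
    exact ⟨c, c.ne_zero, hc.symm⟩
  · simpa using hfa
  · simpa using hgb

end
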